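/- Fix real numbers w, w̄. For natural numbers n₁, n₂ and S : Fin n₁ → Fin n₂ → Bool, let W(S) = w^{|S|} · w̄^{n₁·n₂ − |S|} where |S| is the number of true pairs, let Φ(S) be the condition ∀ x₁ x₂ : Fin n₁, ∀ y₁ y₂ : Fin n₂, S x₁ y₁ ∨ ¬S x₂ y₁ ∨ S x₂ y₂ ∨ ¬S x₁ y₂, let P_a(S) be ∃ x, ∀ y, S x y and P_b(S) be ∃ y, ∀ x, ¬S x y, and define f(n₁,n₂) = ∑_{S with Φ(S) ∧ P_a(S)} W(S) and g(n₁,n₂) = ∑_{S with Φ(S) ∧ P_b(S)} W(S). Then for all n₁ ≥ 1 and n₂ ≥ 1: g(n₁,n₂) = ∑_{ℓ=1}^{n₂} (n₂ choose ℓ) · w̄^{n₁·ℓ} · f(n₁, n₂ − ℓ). -/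

import Mathlib

/-- The number of true pairs of `S`. -/
def numTrue {n₁ n₂ : ℕ} (S : Fin n₁ → Fin n₂ → Bool) : ℕ :=
  (Finset.univ.filter (fun p : Fin n₁ × Fin n₂ => S p.1 p.2 = true)).card

/-- The symmetric weight of `S`: `w^{|S|} · w̄^{n₁·n₂ − |S|}`. -/
noncomputable def Wt (w wbar : ℝ) {n₁ n₂ : ℕ} (S : Fin n₁ → Fin n₂ → Bool) : ℝ :=
  w ^ numTrue S * wbar ^ (n₁ * n₂ - numTrue S)

/-- The query Q_{S4} = ∀x₁∀x₂∀y₁∀y₂ (S(x₁,y₁) ∨ ¬S(x₂,y₁) ∨ S(x₂,y₂) ∨ ¬S(x₁,y₂)). -/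
abbrev PhiS4 {n₁ n₂ : ℕ} (S : Fin n₁ → Fin n₂ → Bool) : Prop :=
  ∀ (x₁ x₂ : Fin n₁) (y₁ y₂ : Fin n₂),
    S x₁ y₁ = true ∨ ¬ S x₂ y₁ = true ∨ S x₂ y₂ = true ∨ ¬ S x₁ y₂ = true

/-- P_a : some row is full. -/
abbrev Pa {n₁ n₂ : ℕ} (S : Fin n₁ → Fin n₂ → Bool) : Prop :=
  ∃ x, ∀ y, S x y = true

/-- P_b : some column is empty. -/
abbrev Pb {n₁ n₂ : ℕ} (S : Fin n₁ → Fin n₂ → Bool) : Prop :=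
  ∃ y, ∀ x, ¬ S x y = true

/-- f(n₁,n₂) : the weighted count of models of Q_{S4} satisfying P_a. -/
noncomputable def fS4 (w wbar : ℝ) (n₁ n₂ : ℕ) : ℝ :=
  ∑ S : Fin n₁ → Fin n₂ → Bool,
    if PhiS4 S ∧ Pa S then Wt w wbar S else 0

/-- g(n₁,n₂) : the weighted count of models of Q_{S4} satisfying P_b. -/
noncomputable def gS4 (w wbar : ℝ) (n₁ n₂ : ℕ) : ℝ :=
  ∑ S : Fin n₁ → Fin n₂ → Bool,
    if PhiS4 S ∧ Pb S then Wt w wbar S else 0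

lemma Wt_eq_prod (w wbar : ℝ) {n₁ n₂ : ℕ} (S : Fin n₁ → Fin n₂ → Bool) :
    Wt w wbar S = ∏ x, ∏ y, (if S x y = true then w else wbar) := by
  rw [← Fintype.prod_prod_type' (f := fun x y => if S x y = true then w else wbar)]
  rw [Finset.prod_ite, Finset.prod_const, Finset.prod_const]
  unfold Wt numTrue
  congr 2
  have h := Finset.card_filter_add_card_filter_not (s := (Finset.univ : Finset (Fin n₁ × Fin n₂)))
    (fun p => S p.1 p.2 = true)
  simp only [Finset.card_univ, Fintype.card_prod, Fintype.card_fin] at h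
  omega

lemma Pa_of_cols {n₁ n₂ : ℕ} (h1 : 1 ≤ n₁) (S : Fin n₁ → Fin n₂ → Bool) (hS : PhiS4 S)
    (hc : ∀ y, ∃ x, S x y = true) : Pa S := by
  obtain ⟨x, -, hx⟩ := Finset.exists_max_image (Finset.univ : Finset (Fin n₁))
    (fun x => (Finset.univ.filter (fun y => S x y = true)).card) ⟨⟨0, h1⟩, Finset.mem_univ _⟩
  refine ⟨x, fun y => ?_⟩
  by_contra hy
  obtain ⟨x', hx'⟩ := hc y
  have := hx x' (Finset.mem_univ _)
  refine absurd this (not_le.mpr (Finset.card_lt_card ?_))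
  rw [Finset.ssubset_iff_of_subset]
  · exact ⟨y, by simpa using hx', by simpa using hy⟩
  · intro z hz
    simp only [Finset.mem_filter, Finset.mem_univ, true_and] at hz ⊢
    rcases hS x x' y z with h | h | h | h
    · exact absurd h hy
    · exact absurd hx' h
    · exact h
    · exact absurd hz h

/-- The set of empty columns. -/
def emptyCols {n₁ n₂ : ℕ} (S : Fin n₁ → Fin n₂ → Bool) : Finset (Fin n₂) :=
  Finset.univ.filter (fun y => ∀ x, ¬ S x y = true)

lemma mem_emptyCols {n₁ n₂ : ℕ} (S : Fin n₁ → Fin n₂ → Bool) (y : Fin n₂) :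
    y ∈ emptyCols S ↔ ∀ x, ¬ S x y = true := by
  simp [emptyCols]

lemma fiber_sum (w wbar : ℝ) {n₁ n₂ : ℕ} (h1 : 1 ≤ n₁) (Y : Finset (Fin n₂)) :
    ∑ S ∈ Finset.univ.filter (fun S : Fin n₁ → Fin n₂ → Bool => PhiS4 S ∧ emptyCols S = Y),
      Wt w wbar S = wbar ^ (n₁ * Y.card) * fS4 w wbar n₁ (n₂ - Y.card) := by
  have e : Fin (n₂ - Y.card) ≃ {y // y ∉ Y} := by
    refine (Fintype.equivFinOfCardEq ?_).symm
    simp [Fintype.card_subtype_compl]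
  unfold fS4
  rw [← Finset.sum_filter, Finset.mul_sum]
  refine Finset.sum_bij' (fun S _ x k => S x (e k))
    (fun T _ x y => if h : y ∈ Y then false else T x (e.symm ⟨y, h⟩)) ?_ ?_ ?_ ?_ ?_
  · intro S hS
    simp only [Finset.mem_filter, Finset.mem_univ, true_and] at hS ⊢
    obtain ⟨hP, rfl⟩ := hS
    have hP' : PhiS4 (fun x k => S x (e k)) := fun x₁ x₂ y₁ y₂ => hP x₁ x₂ (e y₁) (e y₂)
    refine ⟨hP', Pa_of_cols h1 _ hP' fun k => ?_⟩
    have := (e k).2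
    rw [mem_emptyCols] at this
    push Not at this
    exact this
  · intro T hT
    simp only [Finset.mem_filter, Finset.mem_univ, true_and] at hT ⊢
    obtain ⟨hP, x, hx⟩ := hT
    constructor
    · intro x₁ x₂ y₁ y₂
      by_cases a : y₁ ∈ Y
      · simp [a]
      · by_cases b : y₂ ∈ Y
        · simp [b]
        · simpa only [a, b, dite_false] using hP x₁ x₂ (e.symm ⟨y₁, a⟩) (e.symm ⟨y₂, b⟩)
    · ext y
      rw [mem_emptyCols]
      by_cases a : y ∈ Y
      · simp [a]
      · simp only [a, dite_false, iff_false]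
        exact fun h => h x (hx _)
  · intro S hS
    simp only [Finset.mem_filter, Finset.mem_univ, true_and] at hS
    obtain ⟨hP, rfl⟩ := hS
    funext x y
    by_cases a : y ∈ emptyCols S
    · have := (mem_emptyCols S y).1 a x
      simp [a, this]
    · simp [a]
  · intro T hT
    funext x k
    have := (e k).2
    simp [this]
  · intro S hS
    simp only [Finset.mem_filter, Finset.mem_univ, true_and] at hS
    obtain ⟨hP, hY⟩ := hS
    rw [Wt_eq_prod, Wt_eq_prod]
    have key : ∀ x, ∏ y, (if S x y = true then w else wbar) =
        wbar ^ Y.card * ∏ k, (if S x (e k) = true then w else wbar) := by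
      intro x
      rw [← Fintype.prod_subtype_mul_prod_subtype (fun y => y ∈ Y)]
      congr 1
      · rw [Finset.prod_congr rfl (g := fun _ => wbar)]
        · simp
        · intro y _
          have hy := (mem_emptyCols S y.1).1 (hY.symm ▸ y.2) x
          exact if_neg hy
      · exact (Equiv.prod_comp e (fun y : {y // y ∉ Y} => if S x y = true then w else wbar)).symm
    simp_rw [key]
    rw [Finset.prod_mul_distrib, Finset.prod_const, Finset.card_univ, Fintype.card_fin, ← pow_mul,
      mul_comm n₁]

/-- Recurrence for g : g(n₁,n₂) = ∑_{ℓ=1}^{n₂} C(n₂,ℓ) · w̄^{n₁·ℓ} · f(n₁, n₂−ℓ). -/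
theorem gS4_recurrence (w wbar : ℝ) (n₁ n₂ : ℕ) (h1 : 1 ≤ n₁) (h2 : 1 ≤ n₂) :
    gS4 w wbar n₁ n₂ =
      ∑ l ∈ Finset.Icc 1 n₂,
        (n₂.choose l : ℝ) * wbar ^ (n₁ * l) * fS4 w wbar n₁ (n₂ - l) := by
  have hg : gS4 w wbar n₁ n₂ = ∑ Y : Finset (Fin n₂), if 1 ≤ Y.card then
      wbar ^ (n₁ * Y.card) * fS4 w wbar n₁ (n₂ - Y.card) else 0 := by
    unfold gS4
    rw [← Finset.sum_fiberwise (s := Finset.univ) (g := emptyCols)]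
    refine Finset.sum_congr rfl fun Y _ => ?_
    have hPb : ∀ S : Fin n₁ → Fin n₂ → Bool, emptyCols S = Y → (Pb S ↔ 1 ≤ Y.card) := by
      rintro S rfl
      rw [Nat.succ_le_iff, Finset.card_pos]
      exact exists_congr fun y => (mem_emptyCols S y).symm
    split_ifs with hY
    · rw [← fiber_sum w wbar h1 Y, Finset.sum_filter, Finset.sum_filter]
      refine Finset.sum_congr rfl fun S _ => ?_
      by_cases h : emptyCols S = Y
      · have := (hPb S h).2 hY
        simp only [h, this, and_true, if_true]
      · simp only [h, and_false, if_false]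
    · refine Finset.sum_eq_zero fun S hS => ?_
      rw [if_neg]
      rintro ⟨-, hb⟩
      exact hY ((hPb S (by simpa using hS)).1 hb)
  rw [hg, ← Finset.powerset_univ, Finset.sum_powerset_apply_card (fun l => if 1 ≤ l then
      wbar ^ (n₁ * l) * fS4 w wbar n₁ (n₂ - l) else 0)]
  rw [Finset.card_univ, Fintype.card_fin]
  symm
  apply Finset.sum_subset_zero_on_sdiff
  · intro l hl
    simp only [Finset.mem_Icc, Finset.mem_range] at hl ⊢
    omega
  · intro l hl
    simp only [Finset.mem_sdiff, Finset.mem_Icc, Finset.mem_range] at hl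
    rw [if_neg (by omega), smul_zero]
  · intro l hl
    rw [if_pos (Finset.mem_Icc.1 hl).1, nsmul_eq_mul, mul_assoc]
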